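/- (Logarithmic inequality for the pinching.) For every n ≥ 1, log ρ_n ≤ log E_{σ_n}(ρ_n) + (log v(σ_n)) · I in the Loewner order, where v(σ_n) is the number of distinct eigenvalues of σ_n. -/

import Mathlib

open Matrix Filter
open scoped ComplexOrder

noncomputable section

/-- Functional calculus for a Hermitian matrix: apply `f` to the eigenvalues. -/
def matFun {m : Type*} [Fintype m] [DecidableEq m] (f : ℝ → ℝ) (A : Matrix m m ℂ) :
    Matrix m m ℂ :=
  if hA : A.IsHermitian then
    (hA.eigenvectorUnitary : Matrix m m ℂ) *
      Matrix.diagonal (fun i => (f (hA.eigenvalues i) : ℂ)) *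
      star (hA.eigenvectorUnitary : Matrix m m ℂ)
  else 0

/-- Matrix logarithm (via functional calculus). -/
def matLog {m : Type*} [Fintype m] [DecidableEq m] (A : Matrix m m ℂ) : Matrix m m ℂ :=
  matFun Real.log A

/-- Real matrix power (via functional calculus). -/
def matRPow {m : Type*} [Fintype m] [DecidableEq m] (A : Matrix m m ℂ) (s : ℝ) :
    Matrix m m ℂ :=
  matFun (fun x => x ^ s) A

open Classical in
/-- The finite set of (distinct, real) eigenvalues of a Hermitian matrix. -/
def eigFinset {m : Type*} [Fintype m] [DecidableEq m] (A : Matrix m m ℂ) : Finset ℝ :=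
  if hA : A.IsHermitian then Finset.image hA.eigenvalues Finset.univ else ∅

/-- `v A`: the number of distinct eigenvalues of a Hermitian matrix `A`. -/
def numEig {m : Type*} [Fintype m] [DecidableEq m] (A : Matrix m m ℂ) : ℕ :=
  (eigFinset A).card

/-- The spectral projection of a Hermitian matrix `A` corresponding to eigenvalue `μ`. -/
def specProj {m : Type*} [Fintype m] [DecidableEq m] (A : Matrix m m ℂ) (μ : ℝ) :
    Matrix m m ℂ :=
  matFun (fun x => if x = μ then 1 else 0) A

/-- The pinching `E_A(B) = Σ_i E_i B E_i` of `B` by the Hermitian matrix `A`. -/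
def pinch {m : Type*} [Fintype m] [DecidableEq m] (A B : Matrix m m ℂ) : Matrix m m ℂ :=
  ∑ μ ∈ eigFinset A, specProj A μ * B * specProj A μ

/-- `{X > 0}`: the projection onto the strictly positive eigenspaces of a Hermitian `X`. -/
def posProj {m : Type*} [Fintype m] [DecidableEq m] (X : Matrix m m ℂ) : Matrix m m ℂ :=
  matFun (fun x => if 0 < x then 1 else 0) X

/-- The `n`-fold tensor (Kronecker) power of a `d × d` matrix, realized on the index type
`Fin n → Fin d`. -/
def tensorPow {d : ℕ} (ρ : Matrix (Fin d) (Fin d) ℂ) (n : ℕ) :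
    Matrix (Fin n → Fin d) (Fin n → Fin d) ℂ :=
  fun x y => ∏ i, ρ (x i) (y i)

/-- A density matrix: positive semidefinite with unit trace. -/
def IsDensity {m : Type*} [Fintype m] [DecidableEq m] (ρ : Matrix m m ℂ) : Prop :=
  ρ.PosSemidef ∧ ρ.trace = 1

/-- A test: an operator `A` with `0 ≤ A ≤ I` in the Loewner order. -/
def IsTest {m : Type*} [Fintype m] [DecidableEq m] (A : Matrix m m ℂ) : Prop :=
  A.PosSemidef ∧ (1 - A).PosSemidef

/-- The quantum relative entropy `D(ρ‖σ) = Tr[ρ (log ρ − log σ)]`. -/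
def relEnt {m : Type*} [Fintype m] [DecidableEq m] (ρ σ : Matrix m m ℂ) : ℝ :=
  ((ρ * (matLog ρ - matLog σ)).trace).re

/-- The error probability of the first kind, `α_n(A) = Tr[ρ_n (I − A)]`. -/
def alphaErr {d : ℕ} (ρ : Matrix (Fin d) (Fin d) ℂ) (n : ℕ)
    (A : Matrix (Fin n → Fin d) (Fin n → Fin d) ℂ) : ℝ :=
  ((tensorPow ρ n * (1 - A)).trace).re

/-- The error probability of the second kind, `β_n(A) = Tr[σ_n A]`. -/
def betaErr {d : ℕ} (σ : Matrix (Fin d) (Fin d) ℂ) (n : ℕ)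
    (A : Matrix (Fin n → Fin d) (Fin n → Fin d) ℂ) : ℝ :=
  ((tensorPow σ n * A).trace).re

/-- `β*_n(ε)`: the minimum type-II error among tests with type-I error at most `ε`. -/
def betaStar {d : ℕ} (ρ σ : Matrix (Fin d) (Fin d) ℂ) (n : ℕ) (ε : ℝ) : ℝ :=
  sInf {b : ℝ | ∃ A : Matrix (Fin n → Fin d) (Fin n → Fin d) ℂ,
    IsTest A ∧ alphaErr ρ n A ≤ ε ∧ b = betaErr σ n A}

theorem matFun_eq_cfc {m : Type*} [Fintype m] [DecidableEq m] (f : ℝ → ℝ) {A : Matrix m m ℂ}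
    (hA : A.IsHermitian) : matFun f A = cfc f A := by
  rw [hA.cfc_eq, Matrix.IsHermitian.cfc, Unitary.conjStarAlgAut_apply, matFun, dif_pos hA]
  rfl

theorem tensorPow_mul {d : ℕ} (A B : Matrix (Fin d) (Fin d) ℂ) (n : ℕ) :
    tensorPow (A * B) n = tensorPow A n * tensorPow B n := by
  ext x y
  simp only [tensorPow, Matrix.mul_apply]
  rw [Finset.prod_univ_sum, Fintype.piFinset_univ]
  simp only [Finset.prod_mul_distrib]

theorem tensorPow_one {d : ℕ} (n : ℕ) :
    tensorPow (1 : Matrix (Fin d) (Fin d) ℂ) n = 1 := by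
  ext x y
  by_cases h : x = y
  · subst h
    simp [tensorPow]
  · rw [Matrix.one_apply_ne h]
    obtain ⟨i, hi⟩ := Function.ne_iff.mp h
    exact Finset.prod_eq_zero (Finset.mem_univ i) (Matrix.one_apply_ne hi)

theorem tensorPow_conjTranspose {d : ℕ} (A : Matrix (Fin d) (Fin d) ℂ) (n : ℕ) :
    tensorPow Aᴴ n = (tensorPow A n)ᴴ := by
  ext x y
  simp [tensorPow, Matrix.conjTranspose_apply]

theorem tensorPow_isHermitian {d : ℕ} {A : Matrix (Fin d) (Fin d) ℂ} (hA : A.IsHermitian) (n : ℕ) :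
    (tensorPow A n).IsHermitian := by
  rw [Matrix.IsHermitian, ← tensorPow_conjTranspose, hA.eq]

open scoped MatrixOrder Matrix.Norms.L2Operator in
theorem tensorPow_posDef {d : ℕ} {A : Matrix (Fin d) (Fin d) ℂ} (hA : A.PosDef) (n : ℕ) :
    (tensorPow A n).PosDef := by
  obtain ⟨B, hB, rfl⟩ := CStarAlgebra.isStrictlyPositive_iff_eq_star_mul_self.mp
    hA.isStrictlyPositive
  obtain ⟨C, hC⟩ := hB.exists_left_inv
  rw [Matrix.star_eq_conjTranspose, tensorPow_mul, tensorPow_conjTranspose]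
  apply Matrix.PosDef.conjTranspose_mul_self
  have h : tensorPow C n * tensorPow B n = 1 := by
    rw [← tensorPow_mul, hC, tensorPow_one]
  intro x y hxy
  have := congrArg (fun v => tensorPow C n *ᵥ v) hxy
  simpa [Matrix.mulVec_mulVec, h] using this

theorem specProj_isHermitian {m : Type*} [Fintype m] [DecidableEq m] {A : Matrix m m ℂ}
    (hA : A.IsHermitian) (μ : ℝ) : (specProj A μ).IsHermitian := by
  rw [specProj, matFun_eq_cfc _ hA]
  exact cfc_predicate (R := ℝ) (p := IsSelfAdjoint) _ A

theorem sum_specProj {m : Type*} [Fintype m] [DecidableEq m] {A : Matrix m m ℂ}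
    (hA : A.IsHermitian) : ∑ μ ∈ eigFinset A, specProj A μ = 1 := by
  classical
  simp only [specProj, matFun, dif_pos hA, ← Finset.sum_mul, ← Finset.mul_sum]
  have h : ∑ μ ∈ eigFinset A,
      Matrix.diagonal (fun i => (((if hA.eigenvalues i = μ then 1 else 0 : ℝ)) : ℂ)) = 1 := by
    ext i j
    rw [Matrix.sum_apply]
    by_cases hij : i = j
    · subst hij
      simp only [Matrix.diagonal_apply_eq, Matrix.one_apply_eq]
      rw [← Complex.ofReal_sum, Finset.sum_ite_eq, if_pos, Complex.ofReal_one]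
      rw [eigFinset, dif_pos hA]
      exact Finset.mem_image_of_mem _ (Finset.mem_univ i)
    · simp [Matrix.diagonal_apply_ne _ hij, Matrix.one_apply_ne hij]
  rw [h, mul_one]
  exact Unitary.coe_mul_star_self _

/-- The pinching inequality `B ≤ v(A) • E_A(B)`. -/
theorem pinch_ineq {m : Type*} [Fintype m] [DecidableEq m] {A B : Matrix m m ℂ}
    (hA : A.IsHermitian) (hB : B.PosSemidef) :
    ((numEig A : ℝ) • pinch A B - B).PosSemidef := by
  have h1 : (∑ i ∈ eigFinset A, ∑ j ∈ eigFinset A,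
      (specProj A i - specProj A j) * B * (specProj A i - specProj A j)).PosSemidef := by
    refine Matrix.posSemidef_sum _ fun i _ => Matrix.posSemidef_sum _ fun j _ => ?_
    have h := hB.mul_mul_conjTranspose_same (specProj A i - specProj A j)
    rwa [((specProj_isHermitian hA i).sub (specProj_isHermitian hA j)).eq] at h
  have hs := sum_specProj hA
  have h2 : (∑ i ∈ eigFinset A, ∑ j ∈ eigFinset A,
      (specProj A i - specProj A j) * B * (specProj A i - specProj A j))
      = (2 : ℝ) • ((numEig A : ℝ) • pinch A B - B) := by
    simp only [sub_mul, mul_sub, Finset.sum_sub_distrib, Finset.sum_const, ← Finset.mul_sum,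
      ← Finset.sum_mul, hs, one_mul, mul_one, ← Finset.smul_sum]
    simp only [numEig, pinch, Nat.cast_smul_eq_nsmul, two_smul]
    abel
  rw [h2] at h1
  have h3 := h1.smul (a := (1 / 2 : ℝ)) (by norm_num)
  rwa [smul_smul, show (1 / 2 : ℝ) * 2 = 1 by norm_num, one_smul] at h3

open scoped MatrixOrder Matrix.Norms.L2Operator in
theorem log_pinch_aux {m : Type*} [Fintype m] [DecidableEq m] [Nonempty m] {A B : Matrix m m ℂ}
    (hA : A.IsHermitian) (hB : B.PosDef) :
    (matLog (pinch A B) + (Real.log (numEig A) : ℂ) • (1 : Matrix m m ℂ)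
      - matLog B).PosSemidef := by
  classical
  have hv : (0 : ℝ) < numEig A := by
    rw [numEig, eigFinset, dif_pos hA, Nat.cast_pos, Finset.card_pos]
    exact Finset.univ_nonempty.image _
  have hle := pinch_ineq hA hB.posSemidef
  have hpd : ((numEig A : ℝ) • pinch A B).PosDef := by
    have := hB.add_posSemidef hle
    rwa [add_sub_cancel] at this
  have hpd' : (pinch A B).PosDef := by
    have := hpd.smul (a := (numEig A : ℝ)⁻¹) (inv_pos.mpr hv)
    rwa [smul_smul, inv_mul_cancel₀ hv.ne', one_smul] at this
  have key : CFC.log B ≤ CFC.log ((numEig A : ℝ) • pinch A B) :=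
    CFC.log_le_log hle hB.isStrictlyPositive
  rw [CFC.log_smul' _ hv hpd'.isStrictlyPositive, Matrix.le_iff] at key
  rw [matLog, matLog, matFun_eq_cfc _ hB.isHermitian, matFun_eq_cfc _ hpd'.isHermitian]
  have e : algebraMap ℝ (Matrix m m ℂ) (Real.log (numEig A))
      = (Real.log (numEig A) : ℂ) • (1 : Matrix m m ℂ) := by
    rw [Algebra.algebraMap_eq_smul_one]
    rfl
  rw [add_comm, e] at key
  exact key

/-- **Logarithmic inequality for the pinching.**
`log ρ_n ≤ log E_{σ_n}(ρ_n) + (log v(σ_n)) · I` in the Loewner order. -/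
theorem pinch_log_inequality {d : ℕ} (hd : 0 < d) (ρ σ : Matrix (Fin d) (Fin d) ℂ)
    (hρ : IsDensity ρ) (hσ : IsDensity σ) (hρpd : ρ.PosDef) (n : ℕ) (hn : 1 ≤ n) :
    (matLog (pinch (tensorPow σ n) (tensorPow ρ n))
      + (Real.log (numEig (tensorPow σ n)) : ℂ) • (1 : Matrix (Fin n → Fin d) (Fin n → Fin d) ℂ)
      - matLog (tensorPow ρ n)).PosSemidef := by
  have : Nonempty (Fin d) := ⟨⟨0, hd⟩⟩
  exact log_pinch_aux (tensorPow_isHermitian hσ.1.isHermitian n) (tensorPow_posDef hρpd n)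

end
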